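/- Let A be a right noetherian, fully right bounded ring and let p be a prime (two-sided) ideal of A which is irreducible as a right ideal. Then for every nonzero submodule K of the right A-module A/p there exists an element x ∈ K whose annihilator Ann(x) = {a ∈ A : xa = 0} equals p; consequently, the cyclic submodule xA of K is isomorphic to A/p as a right A-module. -/

import Mathlib

open MulOpposite

/- We model right `A`-modules as modules over `Aᵐᵒᵖ`, and right ideals of `A` as
`Submodule Aᵐᵒᵖ A` (via `Semiring.toOppositeModule`, where `op r • a = a * r`). -/

/-- A right ideal of `A` is two-sided if it is also closed under left multiplication. -/
def IsTwoSidedRightIdeal {A : Type*} [Ring A] (p : Submodule Aᵐᵒᵖ A) : Prop :=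
  ∀ a ∈ p, ∀ r : A, r * a ∈ p

/-- A prime two-sided ideal of a (noncommutative) ring `A`, viewed as a right ideal. -/
def IsPrimeTwoSidedIdeal {A : Type*} [Ring A] (p : Submodule Aᵐᵒᵖ A) : Prop :=
  IsTwoSidedRightIdeal p ∧ p ≠ ⊤ ∧
    ∀ a b : A, (∀ r : A, a * r * b ∈ p) → a ∈ p ∨ b ∈ p

/-- A right ideal `I` of `A` is irreducible if it is not the intersection of two right
ideals each strictly containing it. -/
def IsIrreducibleRightIdeal {A : Type*} [Ring A] (I : Submodule Aᵐᵒᵖ A) : Prop :=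
  ¬∃ J K : Submodule Aᵐᵒᵖ A, I < J ∧ I < K ∧ I = J ⊓ K

/-- `A` is fully right bounded: for every prime two-sided ideal `p`, every essential right
ideal of the ring `A/p` contains a nonzero two-sided ideal of `A/p` (phrased in `A`). -/
def FullyRightBounded (A : Type*) [Ring A] : Prop :=
  ∀ p : Submodule Aᵐᵒᵖ A, IsPrimeTwoSidedIdeal p →
    ∀ I : Submodule Aᵐᵒᵖ A, p ≤ I →
      (∀ K : Submodule Aᵐᵒᵖ A, p < K → ¬(I ⊓ K ≤ p)) →
        ∃ J : Submodule Aᵐᵒᵖ A, IsTwoSidedRightIdeal J ∧ p < J ∧ J ≤ I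

/-- For a prime two-sided ideal `p` of a fully right bounded ring which is irreducible as a right
ideal, the ring `A/p` has no zero divisors: `x * a ∈ p` forces `x ∈ p` or `a ∈ p`. -/
theorem IsPrimeTwoSidedIdeal.mem_or_mem_of_mul_mem {A : Type*} [Ring A]
    (hfrb : FullyRightBounded A) {p : Submodule Aᵐᵒᵖ A} (hp : IsPrimeTwoSidedIdeal p)
    (hirr : IsIrreducibleRightIdeal p) {x a : A} (h : x * a ∈ p) : x ∈ p ∨ a ∈ p := by
  by_contra! hxa
  obtain ⟨hx, ha⟩ := hxa
  let I : Submodule Aᵐᵒᵖ A :=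
    { carrier := {b | x * b ∈ p}
      zero_mem' := by simp
      add_mem' := fun {b c} hb hc => by
        simpa [mul_add] using p.add_mem hb hc
      smul_mem' := fun r b hb => by
        simpa [mul_assoc] using p.smul_mem r hb }
  have hpI : p < I := lt_of_le_of_ne (fun b hb => hp.1 b hb x) fun h_eq => ha (h_eq ▸ h)
  obtain ⟨J, hJ, hpJ, hJI⟩ := hfrb p hp I hpI.le fun K hK hIK =>
    hirr ⟨I, K, hpI, hK, le_antisymm (le_inf hpI.le hK.le) hIK⟩
  obtain ⟨j, hj, hjp⟩ := SetLike.exists_of_lt hpJ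
  refine (hp.2.2 x j fun r => ?_).elim hx hjp
  rw [mul_assoc]
  exact hJI (hJ j hj r)

/-- If the annihilator of `x` is the right ideal `p`, then the cyclic right module generated by
`x` is isomorphic to `A/p`. -/
theorem nonempty_span_singleton_equiv_quotient {A M : Type*} [Ring A] [AddCommGroup M]
    [Module Aᵐᵒᵖ M] {p : Submodule Aᵐᵒᵖ A} {x : M} (h : ∀ a : A, op a • x = 0 ↔ a ∈ p) :
    Nonempty (↥(Submodule.span Aᵐᵒᵖ ({x} : Set M)) ≃ₗ[Aᵐᵒᵖ] (A ⧸ p)) := by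
  let f : A →ₗ[Aᵐᵒᵖ] M :=
    { toFun := fun a => op a • x
      map_add' := fun a b => by rw [op_add, add_smul]
      map_smul' := fun r a => by simp [mul_smul] }
  have hker : p = LinearMap.ker f := by
    ext a
    exact (h a).symm
  have hrange : LinearMap.range f = Submodule.span Aᵐᵒᵖ ({x} : Set M) := by
    ext m
    rw [Submodule.mem_span_singleton]
    exact ⟨fun ⟨a, ha⟩ => ⟨op a, ha⟩, fun ⟨r, hr⟩ => ⟨r.unop, hr⟩⟩
  exact ⟨((Submodule.quotEquivOfEq _ _ hker).trans
    (f.quotKerEquivRange.trans (LinearEquiv.ofEq _ _ hrange))).symm⟩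

/-- Let `A` be a right noetherian, fully right bounded ring and `p` a prime
two-sided ideal of `A` which is irreducible as a right ideal.  Then every nonzero submodule
`K` of the right `A`-module `A/p` contains an element `x` whose annihilator
`{a : A | x·a = 0}` equals `p`; consequently the cyclic submodule `xA` is isomorphic to
`A/p` as a right `A`-module. -/
theorem exists_elem_ann_eq_prime
    {A : Type*} [Ring A] (_hnoeth : IsNoetherian Aᵐᵒᵖ A) (_hfbn : FullyRightBounded A)
    (p : Submodule Aᵐᵒᵖ A) (hp : IsPrimeTwoSidedIdeal p)
    (hirr : IsIrreducibleRightIdeal p)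
    (K : Submodule Aᵐᵒᵖ (A ⧸ p)) (hK : K ≠ ⊥) :
    ∃ x : A ⧸ p, x ∈ K ∧ (∀ a : A, op a • x = 0 ↔ a ∈ p) ∧
      Nonempty (↥(Submodule.span Aᵐᵒᵖ ({x} : Set (A ⧸ p))) ≃ₗ[Aᵐᵒᵖ] (A ⧸ p)) := by
  obtain ⟨x, hxK, hx⟩ := K.exists_mem_ne_zero_of_ne_bot hK
  have hann : ∀ a : A, op a • x = 0 ↔ a ∈ p := by
    intro a
    obtain ⟨y, rfl⟩ := Submodule.Quotient.mk_surjective p x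
    rw [Ne, Submodule.Quotient.mk_eq_zero] at hx
    rw [← Submodule.Quotient.mk_smul, Submodule.Quotient.mk_eq_zero, op_smul_eq_mul]
    exact ⟨fun h => (hp.mem_or_mem_of_mul_mem _hfbn hirr h).resolve_left hx,
      fun ha => hp.1 a ha y⟩
  exact ⟨x, hxK, hann, nonempty_span_singleton_equiv_quotient hann⟩
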